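/- arXiv:2006.03319 — 9 statements merged into one kernel-verified Lean document; each statement's English description precedes it below -/
import Mathlib

section
/- Pre-Iwasawa decomposition (existence): let M = [[a,b],[c,d]] ∈ Sp(n,ℝ), let y := (d·dᵗ + c·cᵗ)^{-1/2} be the unique symmetric positive-definite square root of (d·dᵗ + c·cᵗ)^{-1}, set X := y·d, Y := −y·c (so that X − iY = y(d + ic)), and x := (b·dᵗ + a·cᵗ)(d·dᵗ + c·cᵗ)^{-1}. Then x and y are symmetric, y is positive definite, the matrices X, Y satisfy XᵗX + YᵗY = X·Xᵗ + Y·Yᵗ = I, XᵗY = YᵗX, Y·Xᵗ = X·Yᵗ, and M = [[I, x],[0, I]] · [[y, 0],[0, y^{-1}]] · [[X, Y],[−Y, X]]. -/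
open Matrix

/-- The standard symplectic structure matrix `J` with `n×n` blocks `[[0, I],[−I, 0]]`. -/
def Jmat (n : ℕ) : Matrix (Fin n ⊕ Fin n) (Fin n ⊕ Fin n) ℝ :=
  fromBlocks 0 1 (-1) 0

theorem Jmat_eq_neg_J (n : ℕ) : Jmat n = -J (Fin n) ℝ := by
  simp [Jmat, J, fromBlocks_neg]

theorem mul_Jmat_mul_transpose {n : ℕ} {M : Matrix (Fin n ⊕ Fin n) (Fin n ⊕ Fin n) ℝ}
    (hM : Mᵀ * Jmat n * M = Jmat n) : M * Jmat n * Mᵀ = Jmat n := by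
  have h : M ∈ symplecticGroup (Fin n) ℝ :=
    SymplecticGroup.mem_iff'.2 (by simpa [Jmat_eq_neg_J] using hM)
  simpa [Jmat_eq_neg_J] using SymplecticGroup.mem_iff.1 h

/-- Pre-Iwasawa decomposition (existence): for `M = [[a,b],[c,d]] ∈ Sp(n,ℝ)`, with
`y` the (unique) symmetric positive-definite square root of `(d·dᵗ + c·cᵗ)⁻¹`,
`X := y·d`, `Y := −y·c` (so that `X − iY = y(d + ic)`) and
`x := (b·dᵗ + a·cᵗ)(d·dᵗ + c·cᵗ)⁻¹`, the matrix `x` is symmetric, `X + iY` satisfies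
the orthogonality relations, and `M` factors as stated. -/
theorem preIwasawa_exists (n : ℕ) (a b c d : Matrix (Fin n) (Fin n) ℝ)
    (hM : (fromBlocks a b c d)ᵀ * Jmat n * fromBlocks a b c d = Jmat n)
    (y : Matrix (Fin n) (Fin n) ℝ) (hy_symm : yᵀ = y) (hy_pd : y.PosDef)
    (hy_sq : y * y = (d * dᵀ + c * cᵀ)⁻¹) :
    letI X := y * d
    letI Y := -(y * c)
    letI x := (b * dᵀ + a * cᵀ) * (d * dᵀ + c * cᵀ)⁻¹
    xᵀ = x ∧
    X.map Complex.ofReal - Complex.I • Y.map Complex.ofReal =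
      y.map Complex.ofReal * (d.map Complex.ofReal + Complex.I • c.map Complex.ofReal) ∧
    Xᵀ * X + Yᵀ * Y = 1 ∧ X * Xᵀ + Y * Yᵀ = 1 ∧
    Xᵀ * Y = Yᵀ * X ∧ Y * Xᵀ = X * Yᵀ ∧
    fromBlocks a b c d =
      fromBlocks 1 x 0 1 * fromBlocks y 0 0 y⁻¹ * fromBlocks X Y (-Y) X := by
  set X := y * d
  set Y := -(y * c)
  set x := (b * dᵀ + a * cᵀ) * (d * dᵀ + c * cᵀ)⁻¹
  have hMt := mul_Jmat_mul_transpose hM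
  have hMt' := hMt
  simp only [Jmat, fromBlocks_transpose, fromBlocks_multiply, fromBlocks_inj, Matrix.mul_zero,
    Matrix.mul_one, Matrix.mul_neg, Matrix.neg_mul, zero_add, add_zero] at hMt'
  obtain ⟨-, hab, -, hcd⟩ := hMt'
  have hyu : IsUnit y := hy_pd.isUnit
  have hyd : IsUnit y.det := (isUnit_iff_isUnit_det y).1 hyu
  have hNu : IsUnit (d * dᵀ + c * cᵀ) := by
    rw [← isUnit_nonsing_inv_iff, ← hy_sq]
    exact hyu.mul hyu
  have hNd : IsUnit (d * dᵀ + c * cᵀ).det := (isUnit_iff_isUnit_det _).1 hNu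
  have hyyN : y * (y * (d * dᵀ + c * cᵀ)) = 1 := by
    rw [← Matrix.mul_assoc, hy_sq, nonsing_inv_mul _ hNd]
  have hyNy : y * (d * dᵀ + c * cᵀ) * y = 1 := mul_eq_one_comm.1 hyyN
  have hNy : (d * dᵀ + c * cᵀ) * y = y⁻¹ :=
    (inv_eq_right_inv (by rw [← Matrix.mul_assoc, hyNy])).symm
  have hXt : Xᵀ = dᵀ * y := by simp only [X, transpose_mul, hy_symm]
  have hYt : Yᵀ = -(cᵀ * y) := by simp only [Y, transpose_neg, transpose_mul, hy_symm]
  have hcd' : c * dᵀ = d * cᵀ := by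
    rw [neg_add_eq_zero] at hcd
    exact hcd.symm
  have hXX : X * Xᵀ + Y * Yᵀ = 1 := by
    rw [hXt, hYt, ← hyNy]
    simp only [X, Y]
    noncomm_ring
  have hYX : Y * Xᵀ = X * Yᵀ := by
    rw [hXt, hYt]
    calc -(y * c) * (dᵀ * y) = -(y * (c * dᵀ) * y) := by noncomm_ring
      _ = y * d * -(cᵀ * y) := by rw [hcd']; noncomm_ring
  set Q := fromBlocks X Y (-Y) X with hQ
  have hQQt : Q * Qᵀ = 1 := by
    rw [hQ, fromBlocks_transpose, fromBlocks_multiply, ← fromBlocks_one, fromBlocks_inj]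
    simp only [transpose_neg, Matrix.mul_neg, Matrix.neg_mul, neg_neg, hYX, neg_add_cancel]
    exact ⟨hXX, trivial, trivial, by rw [add_comm, hXX]⟩
  have hQtQ : Qᵀ * Q = 1 := mul_eq_one_comm.1 hQQt
  have hQJ : Q * Jmat n = Jmat n * Q := by
    simp [hQ, Jmat, fromBlocks_multiply]
  have hQtQ' := hQtQ
  rw [hQ, fromBlocks_transpose, fromBlocks_multiply, ← fromBlocks_one, fromBlocks_inj] at hQtQ'
  simp only [transpose_neg, Matrix.mul_neg, Matrix.neg_mul, neg_neg] at hQtQ'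
  obtain ⟨hXtX, hXtY, -, -⟩ := hQtQ'
  have hxy : x * y⁻¹ = (b * dᵀ + a * cᵀ) * y := by
    simp only [x]
    rw [← hy_sq, Matrix.mul_assoc, mul_nonsing_inv_cancel_right _ _ hyd]
  have hS : fromBlocks a b c d * Qᵀ = fromBlocks y (x * y⁻¹) 0 y⁻¹ := by
    rw [hQ, fromBlocks_transpose, fromBlocks_multiply, fromBlocks_inj, transpose_neg Y, hXt, hYt,
      hxy, ← hNy]
    refine ⟨?_, by noncomm_ring, ?_, by noncomm_ring⟩
    · calc a * (dᵀ * y) + b * -(cᵀ * y) = (-(b * cᵀ) + a * dᵀ) * y := by noncomm_ring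
        _ = y := by rw [hab, Matrix.one_mul]
    · calc c * (dᵀ * y) + d * -(cᵀ * y) = (c * dᵀ - d * cᵀ) * y := by noncomm_ring
        _ = 0 := by rw [hcd', sub_self, Matrix.zero_mul]
  have hSJ : fromBlocks y (x * y⁻¹) 0 y⁻¹ * Jmat n * (fromBlocks y (x * y⁻¹) 0 y⁻¹)ᵀ
      = Jmat n := by
    calc _ = fromBlocks a b c d * (Qᵀ * (Jmat n * Q)) * (fromBlocks a b c d)ᵀ := by
          rw [← hS, transpose_mul, transpose_transpose]
          simp only [Matrix.mul_assoc]
      _ = Jmat n := by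
          rw [← hQJ, ← Matrix.mul_assoc Qᵀ, hQtQ, Matrix.one_mul, hMt]
  refine ⟨?_, ?_, hXtX, hXX, ?_, hYX, ?_⟩
  · rw [hxy] at hSJ
    simp only [Jmat, fromBlocks_transpose, fromBlocks_multiply, fromBlocks_inj, Matrix.mul_zero,
      Matrix.mul_one, Matrix.mul_neg, Matrix.neg_mul, zero_add, add_zero] at hSJ
    have h := neg_add_eq_zero.1 hSJ.1
    rw [transpose_mul, hy_symm, Matrix.mul_assoc] at h
    simp only [x]
    rw [← hy_sq, transpose_mul, transpose_mul, hy_symm, Matrix.mul_assoc, ← h]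
  · have hX : X.map Complex.ofReal = y.map Complex.ofReal * d.map Complex.ofReal :=
      Matrix.map_mul (f := Complex.ofRealHom)
    have hY : Y.map Complex.ofReal = -(y.map Complex.ofReal * c.map Complex.ofReal) := by
      have h : (y * c).map Complex.ofReal = y.map Complex.ofReal * c.map Complex.ofReal :=
        Matrix.map_mul (f := Complex.ofRealHom)
      rw [← h]
      ext i j
      simp [Y]
    rw [hX, hY, Matrix.mul_add, Matrix.mul_smul, smul_neg, sub_neg_eq_add]
  · exact add_neg_eq_zero.1 hXtY
  · calc fromBlocks a b c d = fromBlocks a b c d * Qᵀ * Q := by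
          rw [Matrix.mul_assoc, hQtQ, Matrix.mul_one]
      _ = _ := by
          rw [hS]
          simp [fromBlocks_multiply]
end

section
/- For M = [[a,b],[c,d]] ∈ Sp(n,ℝ), the two expressions for the pre-Iwasawa parameter x coincide: (d·dᵗ + c·cᵗ)^{-1}(d·bᵗ + c·aᵗ) = (b·dᵗ + a·cᵗ)(d·dᵗ + c·cᵗ)^{-1}. -/
open Matrix

theorem mem_symplecticGroup_iff_Jmat {n : ℕ} {M : Matrix (Fin n ⊕ Fin n) (Fin n ⊕ Fin n) ℝ} :
    M ∈ symplecticGroup (Fin n) ℝ ↔ Mᵀ * Jmat n * M = Jmat n := by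
  simp [SymplecticGroup.mem_iff', Jmat_eq_neg_J]

/-- If `e * dᵀ - f * cᵀ = 1`, so that `dᵀ` and `cᵀ` have no common kernel, then the Gram matrix
`d * dᵀ + c * cᵀ` is invertible. -/
theorem isUnit_det_mul_transpose_add {n : ℕ} {c d e f : Matrix (Fin n) (Fin n) ℝ}
    (h : e * dᵀ - f * cᵀ = 1) : IsUnit (d * dᵀ + c * cᵀ).det := by
  rw [isUnit_iff_ne_zero]
  intro hdet
  obtain ⟨v, hv, hSv⟩ := exists_mulVec_eq_zero_iff.mpr hdet
  have hsum : (dᵀ *ᵥ v) ⬝ᵥ (dᵀ *ᵥ v) + (cᵀ *ᵥ v) ⬝ᵥ (cᵀ *ᵥ v) = 0 := by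
    have := congrArg (v ⬝ᵥ ·) hSv
    simpa [add_mulVec, ← mulVec_mulVec, dotProduct_mulVec, ← mulVec_transpose] using this
  have hnonneg (w : Fin n → ℝ) : 0 ≤ w ⬝ᵥ w :=
    Finset.sum_nonneg fun i _ => mul_self_nonneg (w i)
  have hd : dᵀ *ᵥ v = 0 :=
    dotProduct_self_eq_zero.mp (by linarith [hnonneg (dᵀ *ᵥ v), hnonneg (cᵀ *ᵥ v)])
  have hc : cᵀ *ᵥ v = 0 :=
    dotProduct_self_eq_zero.mp (by linarith [hnonneg (dᵀ *ᵥ v), hnonneg (cᵀ *ᵥ v)])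
  apply hv
  rw [← one_mulVec v, ← h, sub_mulVec, ← mulVec_mulVec, ← mulVec_mulVec, hd, hc]
  simp

/-- For `M = [[a,b],[c,d]] ∈ Sp(n,ℝ)`, the two expressions for the pre-Iwasawa
parameter `x` coincide. -/
theorem preIwasawa_x_eq (n : ℕ) (a b c d : Matrix (Fin n) (Fin n) ℝ)
    (hM : (fromBlocks a b c d)ᵀ * Jmat n * fromBlocks a b c d = Jmat n) :
    (d * dᵀ + c * cᵀ)⁻¹ * (d * bᵀ + c * aᵀ) =
      (b * dᵀ + a * cᵀ) * (d * dᵀ + c * cᵀ)⁻¹ := by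
  have hmem := mem_symplecticGroup_iff_Jmat.mpr hM
  have hMt := mem_symplecticGroup_iff_Jmat.mp (SymplecticGroup.transpose_mem hmem)
  have hP := mem_symplecticGroup_iff_Jmat.mp
    (mul_mem hmem (SymplecticGroup.transpose_mem hmem))
  have hone : a * dᵀ - b * cᵀ = 1 := by
    simp only [Jmat, transpose_transpose, fromBlocks_transpose, fromBlocks_multiply,
      fromBlocks_inj] at hMt
    rw [← hMt.2.1]
    simp [sub_eq_neg_add]
  have hcomm : (d * bᵀ + c * aᵀ) * (d * dᵀ + c * cᵀ) =
      (d * dᵀ + c * cᵀ) * (b * dᵀ + a * cᵀ) := by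
    simp only [Jmat, transpose_transpose, fromBlocks_transpose, fromBlocks_multiply,
      fromBlocks_inj, transpose_add, transpose_mul] at hP
    have h := hP.2.2.2
    simp only [mul_zero, mul_one, zero_add, add_zero, mul_neg, neg_mul] at h
    rw [neg_add_eq_zero] at h
    rw [add_comm (d * bᵀ), add_comm (d * dᵀ), add_comm (b * dᵀ)]
    exact h.symm
  have hS := isUnit_det_mul_transpose_add hone
  calc (d * dᵀ + c * cᵀ)⁻¹ * (d * bᵀ + c * aᵀ)
      = (d * dᵀ + c * cᵀ)⁻¹ * ((d * bᵀ + c * aᵀ) * (d * dᵀ + c * cᵀ)) *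
          (d * dᵀ + c * cᵀ)⁻¹ := by
        rw [← mul_assoc, mul_nonsing_inv_cancel_right _ _ hS]
    _ = (b * dᵀ + a * cᵀ) * (d * dᵀ + c * cᵀ)⁻¹ := by
        rw [hcomm, nonsing_inv_mul_cancel_left _ _ hS]
end

section
/- Pre-Iwasawa decomposition (uniqueness): let M = [[a,b],[c,d]] ∈ Sp(n,ℝ) and suppose M = [[I, x],[0, I]] · [[y, 0],[0, y^{-1}]] · [[X, Y],[−Y, X]] where x, y are real symmetric n×n matrices, y is positive definite, and X, Y are real n×n matrices with XᵗX + YᵗY = I and XᵗY = YᵗX. Then necessarily y = (d·dᵗ + c·cᵗ)^{-1/2} (the symmetric positive-definite square root of (d·dᵗ + c·cᵗ)^{-1}), x = (b·dᵗ + a·cᵗ)(d·dᵗ + c·cᵗ)^{-1}, X = y·d, and Y = −y·c. -/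
open Matrix

/-- If `X + iY` has orthonormal columns, it also has orthonormal rows, in real coordinates. -/
lemma mul_transpose_add_eq_one_and_comm {n R : Type*} [Fintype n] [DecidableEq n] [CommRing R]
    {X Y : Matrix n n R} (h₁ : Xᵀ * X + Yᵀ * Y = 1) (h₂ : Xᵀ * Y = Yᵀ * X) :
    X * Xᵀ + Y * Yᵀ = 1 ∧ Y * Xᵀ = X * Yᵀ := by
  have hU : (fromBlocks X Y (-Y) X)ᵀ * fromBlocks X Y (-Y) X = 1 := by
    rw [fromBlocks_transpose, fromBlocks_multiply, ← fromBlocks_one]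
    simp [h₁, h₂, add_comm (Yᵀ * Y)]
  have hU' := mul_eq_one_comm.mp hU
  rw [fromBlocks_transpose, fromBlocks_multiply, ← fromBlocks_one, fromBlocks_inj] at hU'
  obtain ⟨h, h', -, -⟩ := hU'
  refine ⟨h, ?_⟩
  rw [transpose_neg, mul_neg, neg_add_eq_zero] at h'
  exact h'.symm

/-- Pre-Iwasawa decomposition (uniqueness): if `M = [[a,b],[c,d]] ∈ Sp(n,ℝ)` factors as
`[[I, x],[0, I]] · [[y, 0],[0, y⁻¹]] · [[X, Y],[−Y, X]]` with `x, y` symmetric, `y`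
positive definite, `XᵗX + YᵗY = I` and `XᵗY = YᵗX`, then `y` is the symmetric
positive-definite square root of `(d·dᵗ + c·cᵗ)⁻¹`,
`x = (b·dᵗ + a·cᵗ)(d·dᵗ + c·cᵗ)⁻¹`, `X = y·d` and `Y = −y·c`. -/
theorem preIwasawa_unique (n : ℕ) (a b c d : Matrix (Fin n) (Fin n) ℝ)
    (hM : (fromBlocks a b c d)ᵀ * Jmat n * fromBlocks a b c d = Jmat n)
    (x y X Y : Matrix (Fin n) (Fin n) ℝ)
    (hx_symm : xᵀ = x) (hy_symm : yᵀ = y) (hy_pd : y.PosDef)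
    (hXY1 : Xᵀ * X + Yᵀ * Y = 1) (hXY2 : Xᵀ * Y = Yᵀ * X)
    (hfact : fromBlocks a b c d =
      fromBlocks 1 x 0 1 * fromBlocks y 0 0 y⁻¹ * fromBlocks X Y (-Y) X) :
    y * y = (d * dᵀ + c * cᵀ)⁻¹ ∧
    x = (b * dᵀ + a * cᵀ) * (d * dᵀ + c * cᵀ)⁻¹ ∧
    X = y * d ∧ Y = -(y * c) := by
  have hy : IsUnit y.det := (isUnit_iff_isUnit_det y).mp hy_pd.isUnit
  have hyi : y⁻¹ᵀ = y⁻¹ := by rw [transpose_nonsing_inv, hy_symm]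
  obtain ⟨h₁, h₂⟩ := mul_transpose_add_eq_one_and_comm hXY1 hXY2
  simp only [fromBlocks_multiply, one_mul, zero_mul, mul_zero, add_zero, zero_add,
    fromBlocks_inj] at hfact
  obtain ⟨ha, hb, hc, hd⟩ := hfact
  have hden : d * dᵀ + c * cᵀ = y⁻¹ * y⁻¹ := calc
    _ = y⁻¹ * (X * Xᵀ + Y * Yᵀ) * y⁻¹ := by
      rw [hc, hd]
      simp only [transpose_mul, transpose_neg, hyi]
      noncomm_ring
    _ = _ := by rw [h₁, mul_one]
  have hnum : b * dᵀ + a * cᵀ = x * (y⁻¹ * y⁻¹) := calc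
    _ = y * (Y * Xᵀ - X * Yᵀ) * y⁻¹ + x * y⁻¹ * (X * Xᵀ + Y * Yᵀ) * y⁻¹ := by
      rw [ha, hb, hc, hd]
      simp only [transpose_mul, transpose_neg, hyi]
      noncomm_ring
    _ = _ := by rw [h₁, h₂]; simp [mul_assoc]
  have hinv : (y⁻¹ * y⁻¹)⁻¹ = y * y := by rw [Matrix.mul_inv_rev, nonsing_inv_nonsing_inv y hy]
  refine ⟨by rw [hden, hinv], ?_, ?_, ?_⟩
  · rw [hden, hnum, hinv, mul_assoc, mul_assoc, ← mul_assoc y⁻¹ y, nonsing_inv_mul y hy,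
      one_mul, nonsing_inv_mul y hy, mul_one]
  · rw [hd, mul_nonsing_inv_cancel_left _ _ hy]
  · rw [hc, mul_neg, mul_neg, mul_nonsing_inv_cancel_left _ _ hy, neg_neg]
end

section
/- Pre-Iwasawa decomposition (inverse transform): let x, y be real symmetric n×n matrices with y positive definite, and let X, Y be real n×n matrices such that X + iY is unitary (equivalently XᵗX + YᵗY = I and XᵗY = YᵗX). Define a := y·X − x·y^{-1}·Y, b := y·Y + x·y^{-1}·X, c := −y^{-1}·Y, d := y^{-1}·X. Then M := [[a,b],[c,d]] ∈ Sp(n,ℝ), and moreover (d·dᵗ + c·cᵗ)^{-1} = y² and (b·dᵗ + a·cᵗ)(d·dᵗ + c·cᵗ)^{-1} = x. -/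
open Matrix

/-- If the columns of `X + iY` are orthonormal then so are its rows. -/
theorem unitary_blocks_mul_transpose {m : Type*} [Fintype m] [DecidableEq m]
    {X Y : Matrix m m ℝ} (h₁ : Xᵀ * X + Yᵀ * Y = 1) (h₂ : Xᵀ * Y = Yᵀ * X) :
    X * Xᵀ + Y * Yᵀ = 1 ∧ Y * Xᵀ = X * Yᵀ := by
  have h : (fromBlocks X Y (-Y) X)ᵀ * fromBlocks X Y (-Y) X = 1 := by
    have h₁' : Yᵀ * Y + Xᵀ * X = 1 := by rw [add_comm, h₁]
    simp [fromBlocks_transpose, fromBlocks_multiply, h₁, h₁', h₂]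
  rw [mul_eq_one_comm, fromBlocks_transpose, fromBlocks_multiply, ← fromBlocks_one,
    fromBlocks_inj] at h
  obtain ⟨h₁₁, h₁₂, -, -⟩ := h
  refine ⟨h₁₁, ?_⟩
  rw [transpose_neg, mul_neg, neg_add_eq_sub, sub_eq_zero] at h₁₂
  exact h₁₂

/-- Pre-Iwasawa decomposition (inverse transform): given `x, y` symmetric with `y`
positive definite and `X, Y` with `XᵗX + YᵗY = I`, `XᵗY = YᵗX` (i.e. `X + iY` unitary),
the matrix `M := [[a,b],[c,d]]` built from `a := yX − xy⁻¹Y`, `b := yY + xy⁻¹X`,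
`c := −y⁻¹Y`, `d := y⁻¹X` is symplectic, and `(d·dᵗ + c·cᵗ)⁻¹ = y²`,
`(b·dᵗ + a·cᵗ)(d·dᵗ + c·cᵗ)⁻¹ = x`. -/
theorem preIwasawa_inverse (n : ℕ) (x y X Y : Matrix (Fin n) (Fin n) ℝ)
    (hx_symm : xᵀ = x) (hy_symm : yᵀ = y) (hy_pd : y.PosDef)
    (hXY1 : Xᵀ * X + Yᵀ * Y = 1) (hXY2 : Xᵀ * Y = Yᵀ * X) :
    letI a := y * X - x * y⁻¹ * Y
    letI b := y * Y + x * y⁻¹ * X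
    letI c := -(y⁻¹ * Y)
    letI d := y⁻¹ * X
    (fromBlocks a b c d)ᵀ * Jmat n * fromBlocks a b c d = Jmat n ∧
    (d * dᵀ + c * cᵀ)⁻¹ = y * y ∧
    (b * dᵀ + a * cᵀ) * (d * dᵀ + c * cᵀ)⁻¹ = x := by
  obtain ⟨hrow₁, hrow₂⟩ := unitary_blocks_mul_transpose hXY1 hXY2
  have hdet : IsUnit y.det := (isUnit_iff_isUnit_det y).mp hy_pd.isUnit
  have hz : y⁻¹ᵀ = y⁻¹ := by rw [transpose_nonsing_inv, hy_symm]
  have hyz : y * y⁻¹ = 1 := mul_nonsing_inv y hdet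
  have hzy : y⁻¹ * y = 1 := nonsing_inv_mul y hdet
  generalize y⁻¹ = z at hz hyz hzy ⊢
  have hyz' (A : Matrix (Fin n) (Fin n) ℝ) : y * (z * A) = A := by
    rw [← mul_assoc, hyz, one_mul]
  have hzy' (A : Matrix (Fin n) (Fin n) ℝ) : z * (y * A) = A := by
    rw [← mul_assoc, hzy, one_mul]
  have hden : z * X * (z * X)ᵀ + -(z * Y) * (-(z * Y))ᵀ = z * z := by
    calc _ = z * (X * Xᵀ + Y * Yᵀ) * z := by
          simp only [transpose_mul, transpose_neg, hz]; noncomm_ring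
      _ = z * z := by rw [hrow₁, mul_one]
  have hinv : (z * z)⁻¹ = y * y := inv_eq_right_inv (by rw [mul_assoc, hzy', hzy])
  have hnum : (y * Y + x * z * X) * (z * X)ᵀ + (y * X - x * z * Y) * (-(z * Y))ᵀ
      = x * (z * z) := by
    calc _ = y * (Y * Xᵀ - X * Yᵀ) * z + x * z * (X * Xᵀ + Y * Yᵀ) * z := by
          simp only [transpose_mul, transpose_neg, hz]; noncomm_ring
      _ = x * (z * z) := by
          rw [hrow₁, hrow₂, sub_self, mul_zero, zero_mul, zero_add, mul_one, mul_assoc]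
  refine ⟨?_, by rw [hden, hinv], ?_⟩
  · rw [Jmat, fromBlocks_transpose, fromBlocks_multiply, fromBlocks_multiply, fromBlocks_inj]
    simp only [transpose_mul, transpose_neg, transpose_add, transpose_sub, hz, hy_symm, hx_symm,
      mul_zero, mul_one, mul_neg, neg_mul, zero_add, add_zero, neg_neg, mul_add, add_mul, mul_sub,
      sub_mul, mul_assoc, hyz', hzy', hXY2]
    refine ⟨by abel, ?_, ?_, by abel⟩
    · rw [← hXY1]; abel
    · rw [← hXY1]; abel
  · rw [hden, hinv, hnum, mul_assoc, mul_assoc, hzy', hzy, mul_one]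
end

section
/- Let M = [[a,b],[c,d]] ∈ Sp(n,ℝ) and let v' = x' + iy' ∈ 𝒳ₙ. Then cv' + d and v̄'cᵗ + dᵗ are invertible and (av' + b)(cv' + d)^{-1} = (v̄'cᵗ + dᵗ)^{-1}(B/2 + i y')(cv' + d)^{-1}, where B := 2v̄'aᵗcv' + v̄'(cᵗb + aᵗd) + (bᵗc + dᵗa)v' + 2bᵗd. -/
open Matrix

theorem re_star_dotProduct_map_ofReal_mulVec {m : Type*} [Fintype m] (y : Matrix m m ℝ)
    (w : m → ℂ) :
    (star w ⬝ᵥ (y.map Complex.ofReal *ᵥ w)).re =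
      (fun i => (w i).re) ⬝ᵥ (y *ᵥ fun i => (w i).re) +
        (fun i => (w i).im) ⬝ᵥ (y *ᵥ fun i => (w i).im) := by
  simp only [dotProduct, mulVec, Finset.mul_sum, Complex.re_sum, ← Finset.sum_add_distrib]
  refine Finset.sum_congr rfl fun i _ => Finset.sum_congr rfl fun j _ => ?_
  simp

theorem Matrix.PosDef.eq_zero_of_star_dotProduct_map_ofReal_mulVec {m : Type*} [Fintype m]
    {y : Matrix m m ℝ} (hy : y.PosDef) {w : m → ℂ}
    (h : star w ⬝ᵥ (y.map Complex.ofReal *ᵥ w) = 0) : w = 0 := by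
  have hre := re_star_dotProduct_map_ofReal_mulVec y w
  rw [h, Complex.zero_re] at hre
  have hnonneg (u : m → ℝ) : 0 ≤ u ⬝ᵥ (y *ᵥ u) := by
    simpa using hy.posSemidef.dotProduct_mulVec_nonneg u
  have hzero (u : m → ℝ) (hu : u ⬝ᵥ (y *ᵥ u) = 0) : u = 0 := by
    by_contra hne
    have hpos := hy.dotProduct_mulVec_pos hne
    rw [star_trivial, hu] at hpos
    exact hpos.false
  have h₁ := hnonneg fun i => (w i).re
  have h₂ := hnonneg fun i => (w i).im
  have hp := hzero (fun i => (w i).re) (by linarith)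
  have hq := hzero (fun i => (w i).im) (by linarith)
  ext i
  exact Complex.ext (congrFun hp i) (congrFun hq i)

/-- The block relations satisfied by a symplectic matrix. -/
theorem symplectic_block_relations {n : ℕ} {a b c d : Matrix (Fin n) (Fin n) ℝ}
    (hM : (fromBlocks a b c d)ᵀ * Jmat n * fromBlocks a b c d = Jmat n) :
    aᵀ * c = cᵀ * a ∧ aᵀ * d = 1 + cᵀ * b ∧ dᵀ * a = 1 + bᵀ * c ∧ bᵀ * d = dᵀ * b := by
  simp only [Jmat, fromBlocks_transpose, fromBlocks_multiply, mul_zero, mul_one, mul_neg,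
    zero_add, add_zero, neg_mul, fromBlocks_inj] at hM
  obtain ⟨h₁, h₂, h₃, h₄⟩ := hM
  refine ⟨?_, ?_, ?_, ?_⟩
  · rw [← sub_eq_zero, ← h₁]; abel
  · rw [← h₂]; abel
  · rw [← neg_neg (1 : Matrix (Fin n) (Fin n) ℝ), ← h₃]; abel
  · rw [← sub_eq_zero, ← h₄]; abel

/-- If the skew-Hermitian part of `Pᴴ * Q` is `i y` with `y` positive definite, then `P` is
invertible. -/
theorem isUnit_of_conjTranspose_mul_sub {m : Type*} [Fintype m] [DecidableEq m]
    {y : Matrix m m ℝ} (hy : y.PosDef) {P Q : Matrix m m ℂ}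
    (h : Pᴴ * Q - Qᴴ * P = (2 * Complex.I) • y.map Complex.ofReal) : IsUnit P := by
  rw [isUnit_iff_isUnit_det, isUnit_iff_ne_zero]
  intro hdet
  obtain ⟨w, hw, hPw⟩ := exists_mulVec_eq_zero_iff.mpr hdet
  apply hw
  apply hy.eq_zero_of_star_dotProduct_map_ofReal_mulVec
  have hform := congrArg (fun A => star w ⬝ᵥ (A *ᵥ w)) h
  have hleft : star w ⬝ᵥ (Pᴴ *ᵥ (Q *ᵥ w)) = 0 := by
    rw [dotProduct_mulVec, ← star_mulVec, hPw, star_zero, zero_dotProduct]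
  simp only [sub_mulVec, ← mulVec_mulVec, hPw, mulVec_zero, sub_zero, smul_mulVec,
    dotProduct_smul, hleft, smul_eq_mul] at hform
  simpa using hform.symm

/-- For `M = [[a,b],[c,d]] ∈ Sp(n,ℝ)` and `v' = x' + iy' ∈ 𝒳ₙ`, the matrices
`cv' + d` and `v̄'cᵗ + dᵗ` are invertible and
`(av' + b)(cv' + d)⁻¹ = (v̄'cᵗ + dᵗ)⁻¹ (B/2 + i y') (cv' + d)⁻¹` with
`B = 2v̄'aᵗcv' + v̄'(cᵗb + aᵗd) + (bᵗc + dᵗa)v' + 2bᵗd`. -/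
theorem moebius_alt_formula (n : ℕ) (a b c d : Matrix (Fin n) (Fin n) ℝ)
    (hM : (fromBlocks a b c d)ᵀ * Jmat n * fromBlocks a b c d = Jmat n)
    (x' y' : Matrix (Fin n) (Fin n) ℝ)
    (hx_symm : x'ᵀ = x') (hy_symm : y'ᵀ = y') (hy_pd : y'.PosDef) :
    letI aC := a.map Complex.ofReal
    letI bC := b.map Complex.ofReal
    letI cC := c.map Complex.ofReal
    letI dC := d.map Complex.ofReal
    letI v' := x'.map Complex.ofReal + Complex.I • y'.map Complex.ofReal
    letI vbar := x'.map Complex.ofReal - Complex.I • y'.map Complex.ofReal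
    letI B := 2 • (vbar * aCᵀ * cC * v') + vbar * (cCᵀ * bC + aCᵀ * dC) +
      (bCᵀ * cC + dCᵀ * aC) * v' + 2 • (bCᵀ * dC)
    IsUnit (cC * v' + dC) ∧ IsUnit (vbar * cCᵀ + dCᵀ) ∧
    (aC * v' + bC) * (cC * v' + dC)⁻¹ =
      (vbar * cCᵀ + dCᵀ)⁻¹ *
        ((2 : ℂ)⁻¹ • B + Complex.I • y'.map Complex.ofReal) * (cC * v' + dC)⁻¹ := by
  let aC := a.map Complex.ofReal
  let bC := b.map Complex.ofReal
  let cC := c.map Complex.ofReal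
  let dC := d.map Complex.ofReal
  let v' := x'.map Complex.ofReal + Complex.I • y'.map Complex.ofReal
  let vbar := x'.map Complex.ofReal - Complex.I • y'.map Complex.ofReal
  let B := 2 • (vbar * aCᵀ * cC * v') + vbar * (cCᵀ * bC + aCᵀ * dC) +
    (bCᵀ * cC + dCᵀ * aC) * v' + 2 • (bCᵀ * dC)
  change IsUnit (cC * v' + dC) ∧ IsUnit (vbar * cCᵀ + dCᵀ) ∧
    (aC * v' + bC) * (cC * v' + dC)⁻¹ =
      (vbar * cCᵀ + dCᵀ)⁻¹ *
        ((2 : ℂ)⁻¹ • B + Complex.I • y'.map Complex.ofReal) * (cC * v' + dC)⁻¹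
  obtain ⟨hac, had, hda, hbd⟩ := symplectic_block_relations hM
  have hmul (p q : Matrix (Fin n) (Fin n) ℝ) :
      (p * q).map Complex.ofReal = p.map Complex.ofReal * q.map Complex.ofReal :=
    Matrix.map_mul (f := Complex.ofRealHom)
  have hadd (p q : Matrix (Fin n) (Fin n) ℝ) :
      (p + q).map Complex.ofReal = p.map Complex.ofReal + q.map Complex.ofReal :=
    Matrix.map_add _ Complex.ofReal_add p q
  have hone : (1 : Matrix (Fin n) (Fin n) ℝ).map Complex.ofReal = 1 :=
    Matrix.map_one _ Complex.ofReal_zero Complex.ofReal_one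
  have hstar (p : Matrix (Fin n) (Fin n) ℝ) :
      (p.map Complex.ofReal)ᴴ = (p.map Complex.ofReal)ᵀ := by
    ext i j; simp
  have hacC : aCᵀ * cC = cCᵀ * aC := by
    simpa only [hmul, transpose_map] using congrArg (fun p => p.map Complex.ofReal) hac
  have hadC : aCᵀ * dC = 1 + cCᵀ * bC := by
    simpa only [hmul, hadd, hone, transpose_map] using
      congrArg (fun p => p.map Complex.ofReal) had
  have hdaC : dCᵀ * aC = 1 + bCᵀ * cC := by
    simpa only [hmul, hadd, hone, transpose_map] using
      congrArg (fun p => p.map Complex.ofReal) hda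
  have hbdC : bCᵀ * dC = dCᵀ * bC := by
    simpa only [hmul, transpose_map] using congrArg (fun p => p.map Complex.ofReal) hbd
  have hv : v'ᴴ = vbar := by
    simp only [v', vbar, conjTranspose_add, conjTranspose_smul, hstar, ← transpose_map, hx_symm,
      hy_symm, Complex.star_def, Complex.conj_I, neg_smul, sub_eq_add_neg]
  have hsub : v' - vbar = (2 * Complex.I) • y'.map Complex.ofReal := by
    simp only [v', vbar]
    module
  have hP : (cC * v' + dC)ᴴ = vbar * cCᵀ + dCᵀ := by
    rw [conjTranspose_add, conjTranspose_mul, hv, hstar, hstar]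
  have hQ : (aC * v' + bC)ᴴ = vbar * aCᵀ + bCᵀ := by
    rw [conjTranspose_add, conjTranspose_mul, hv, hstar, hstar]
  have hPQ : (vbar * cCᵀ + dCᵀ) * (aC * v' + bC) =
      vbar * (cCᵀ * aC) * v' + vbar * (cCᵀ * bC) + dCᵀ * aC * v' + dCᵀ * bC := by
    noncomm_ring
  have hQP : (vbar * aCᵀ + bCᵀ) * (cC * v' + dC) =
      vbar * (aCᵀ * cC) * v' + vbar * (aCᵀ * dC) + bCᵀ * cC * v' + bCᵀ * dC := by
    noncomm_ring
  have hunit : IsUnit (cC * v' + dC) := by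
    refine isUnit_of_conjTranspose_mul_sub hy_pd (Q := aC * v' + bC) ?_
    rw [hP, hQ, hPQ, hQP, hacC, hadC, hdaC, hbdC, ← hsub]
    noncomm_ring
  have hunit' : IsUnit (vbar * cCᵀ + dCᵀ) := by
    rw [← hP]
    exact hunit.star
  refine ⟨hunit, hunit', ?_⟩
  have hnum : (2 : ℂ)⁻¹ • B + Complex.I • y'.map Complex.ofReal =
      (vbar * cCᵀ + dCᵀ) * (aC * v' + bC) := by
    have hI : Complex.I • y'.map Complex.ofReal = (2 : ℂ)⁻¹ • (v' - vbar) := by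
      rw [hsub]
      module
    rw [hPQ, hI]
    simp only [B]
    rw [hadC, hdaC, hbdC, mul_assoc vbar aCᵀ cC, hacC]
    simp only [mul_add, add_mul, mul_one, one_mul]
    module
  rw [hnum, nonsing_inv_mul_cancel_left _ _ ((isUnit_iff_isUnit_det _).mp hunit')]
end

section
/- Let M = [[a,b],[c,d]] ∈ Sp(n,ℝ), let λ, μ ∈ M(1,n,ℝ) be row vectors, κ ∈ ℝ, and set (p,q) := (λ,μ)M^{-1}, i.e. p = λdᵗ − μcᵗ and q = −λbᵗ + μaᵗ. Then the (2n+2)×(2n+2) real block matrix g with block rows [a, 0_{n×1}, b, qᵗ], [λ, 1, μ, κ], [c, 0_{n×1}, d, −pᵗ], [0_{1×n}, 0, 0_{1×n}, 1] belongs to Sp(n+1,ℝ), i.e. gᵗJ_{n+1}g = J_{n+1}. -/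
open Matrix

/-- The symplectic structure matrix `J` of size `2(n+1)`, with `(n+1)×(n+1)` blocks
`[[0, I],[−I, 0]]`, where the index set of size `n+1` is realized as `Fin n ⊕ Fin 1`. -/
def Jmat' (n : ℕ) :
    Matrix ((Fin n ⊕ Fin 1) ⊕ (Fin n ⊕ Fin 1)) ((Fin n ⊕ Fin 1) ⊕ (Fin n ⊕ Fin 1)) ℝ :=
  fromBlocks 0 1 (-1) 0

/-- The embedding of the real Jacobi group element `(M,(λ,μ),κ)` in `Sp(n+1,ℝ)`:
the `(2n+2)×(2n+2)` matrix with block rows `[a, 0, b, qᵗ]`, `[λ, 1, μ, κ]`,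
`[c, 0, d, −pᵗ]`, `[0, 0, 0, 1]`, where `p = λdᵗ − μcᵗ` and `q = −λbᵗ + μaᵗ`. -/
def jacobiEmbed (n : ℕ) (a b c d : Matrix (Fin n) (Fin n) ℝ)
    (lam mu : Matrix (Fin 1) (Fin n) ℝ) (κ : ℝ) :
    Matrix ((Fin n ⊕ Fin 1) ⊕ (Fin n ⊕ Fin 1)) ((Fin n ⊕ Fin 1) ⊕ (Fin n ⊕ Fin 1)) ℝ :=
  fromBlocks
    (fromBlocks a 0 lam 1)
    (fromBlocks b (-(lam * bᵀ) + mu * aᵀ)ᵀ mu !![κ])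
    (fromBlocks c 0 0 0)
    (fromBlocks d (-(lam * dᵀ - mu * cᵀ)ᵀ) 0 1)

/-- A block matrix preserves the standard symplectic form iff `aᵀc` and `bᵀd` are symmetric and
`aᵀd - cᵀb = 1`. -/
theorem fromBlocks_transpose_mul_form_mul_iff {m R : Type*} [Fintype m] [DecidableEq m]
    [CommRing R] (a b c d : Matrix m m R) :
    (fromBlocks a b c d)ᵀ * fromBlocks 0 1 (-1) 0 * fromBlocks a b c d = fromBlocks 0 1 (-1) 0 ↔
      aᵀ * c = cᵀ * a ∧ aᵀ * d = cᵀ * b + 1 ∧ bᵀ * d = dᵀ * b := by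
  have key : (fromBlocks a b c d)ᵀ * fromBlocks 0 1 (-1) 0 * fromBlocks a b c d =
      fromBlocks (aᵀ * c - cᵀ * a) (aᵀ * d - cᵀ * b) (bᵀ * c - dᵀ * a) (bᵀ * d - dᵀ * b) := by
    simp [fromBlocks_transpose, fromBlocks_multiply, neg_add_eq_sub]
  rw [key, fromBlocks_inj, sub_eq_zero, sub_eq_zero, sub_eq_iff_eq_add']
  constructor
  · rintro ⟨h₁, h₂, -, h₄⟩
    exact ⟨h₁, h₂, h₄⟩
  · rintro ⟨h₁, h₂, h₄⟩
    refine ⟨h₁, h₂, ?_, h₄⟩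
    have h₃ := congrArg transpose h₂
    simp only [transpose_mul, transpose_add, transpose_transpose, transpose_one] at h₃
    rw [h₃]
    abel

/-- A square matrix indexed by a type with at most one element is symmetric. -/
theorem transpose_eq_self_of_subsingleton {m R : Type*} [Subsingleton m] (x : Matrix m m R) :
    xᵀ = x := by
  ext i j
  rw [transpose_apply, Subsingleton.elim i j]

/-- The embedded matrix of a real Jacobi group element belongs to `Sp(n+1,ℝ)`. -/
theorem jacobiEmbed_mem_symplectic (n : ℕ) (a b c d : Matrix (Fin n) (Fin n) ℝ)
    (hM : (fromBlocks a b c d)ᵀ * Jmat n * fromBlocks a b c d = Jmat n)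
    (lam mu : Matrix (Fin 1) (Fin n) ℝ) (κ : ℝ) :
    (jacobiEmbed n a b c d lam mu κ)ᵀ * Jmat' n * jacobiEmbed n a b c d lam mu κ =
      Jmat' n := by
  obtain ⟨hac, had, hbd⟩ := (fromBlocks_transpose_mul_form_mul_iff a b c d).1 hM
  have hda : dᵀ * a = bᵀ * c + 1 := by
    simpa using congrArg transpose had
  refine (fromBlocks_transpose_mul_form_mul_iff _ _ _ _).2 ⟨?_, ?_, ?_⟩
  · simp [fromBlocks_transpose, fromBlocks_multiply, hac]
  · simp only [fromBlocks_transpose, fromBlocks_multiply]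
    rw [← fromBlocks_one, fromBlocks_add, fromBlocks_inj]
    refine ⟨by simp [had], ?_, by simp, by simp⟩
    simp [Matrix.mul_add, Matrix.mul_sub, ← Matrix.mul_assoc, hac, had, Matrix.add_mul]
    abel
  · simp only [fromBlocks_transpose, fromBlocks_multiply]
    rw [fromBlocks_inj]
    refine ⟨by simp [hbd], ?_, ?_, ?_⟩
    · simp [Matrix.mul_add, Matrix.mul_sub, ← Matrix.mul_assoc, hbd, hda, Matrix.add_mul]
      abel
    · simp [Matrix.add_mul, Matrix.sub_mul, Matrix.mul_assoc, hbd, had, Matrix.mul_add]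
      abel
    · rw [← transpose_eq_self_of_subsingleton (_ + _)]
      simp [transpose_eq_self_of_subsingleton !![κ]]
end

section
/- Invariance of the one-form λ^R = dκ − p·dqᵗ + q·dpᵗ under the Jacobi group action: fix (M,(λ,μ),κ) with M = [[a,b],[c,d]] ∈ Sp(n,ℝ), row vectors λ, μ ∈ M(1,n,ℝ), κ ∈ ℝ, and set p := λdᵗ − μcᵗ, q := −λbᵗ + μaᵗ. Let p', q' : ℝ → M(1,n,ℝ) and κ' : ℝ → ℝ be differentiable, and define the transformed curves p₁(t) := p + p'(t)dᵗ − q'(t)cᵗ, q₁(t) := q − p'(t)bᵗ + q'(t)aᵗ, κ₁(t) := κ + κ'(t) + λ·q'(t)ᵗ − μ·p'(t)ᵗ. Then for every t: dκ₁/dt(t) − p₁(t)·(dq₁/dt(t))ᵗ + q₁(t)·(dp₁/dt(t))ᵗ = dκ'/dt(t) − p'(t)·(dq'/dt(t))ᵗ + q'(t)·(dp'/dt(t))ᵗ. -/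
open Matrix

/-- Entrywise derivative of a matrix-valued function of a real variable. -/
noncomputable def mderiv {m k : Type*} (f : ℝ → Matrix m k ℝ) (t : ℝ) : Matrix m k ℝ :=
  Matrix.of fun i j => deriv (fun s => f s i j) t

/-- Entrywise differentiability passes to the product with a constant matrix on the right. -/
theorem hasDerivAt_mul_const_apply {l m k : Type*} [Fintype m] {f : ℝ → Matrix l m ℝ} {t : ℝ}
    (hf : ∀ i j, DifferentiableAt ℝ (fun s => f s i j) t) (B : Matrix m k ℝ) (i : l) (j : k) :
    HasDerivAt (fun s => (f s * B) i j) ((mderiv f t * B) i j) t := by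
  simp only [mul_apply]
  exact HasDerivAt.fun_sum fun x _ => (hf i x).hasDerivAt.mul_const (B x j)

/-- Entrywise differentiability passes to the product of a constant matrix with the transpose. -/
theorem hasDerivAt_const_mul_transpose_apply {l m k : Type*} [Fintype m]
    {f : ℝ → Matrix l m ℝ} {t : ℝ}
    (hf : ∀ i j, DifferentiableAt ℝ (fun s => f s i j) t) (A : Matrix k m ℝ) (i : k) (j : l) :
    HasDerivAt (fun s => (A * (f s)ᵀ) i j) ((A * (mderiv f t)ᵀ) i j) t := by
  simp only [mul_apply, transpose_apply]
  exact HasDerivAt.fun_sum fun x _ => (hf j x).hasDerivAt.const_mul (A i x)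

/-- The symplectic pairing of row vectors is invariant under a symplectic matrix. -/
theorem symplectic_pairing_invariant {n : ℕ} {l k : Type*} {a b c d : Matrix (Fin n) (Fin n) ℝ}
    (hM : (fromBlocks a b c d)ᵀ * Jmat n * fromBlocks a b c d = Jmat n)
    (x y : Matrix l (Fin n) ℝ) (u v : Matrix k (Fin n) ℝ) :
    (x * dᵀ - y * cᵀ) * (-(u * bᵀ) + v * aᵀ)ᵀ - (-(x * bᵀ) + y * aᵀ) * (u * dᵀ - v * cᵀ)ᵀ =
      x * vᵀ - y * uᵀ := by
  obtain ⟨h₁, h₂, h₃, h₄⟩ := symplectic_block_relations hM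
  have e₁ : y * aᵀ * (c * vᵀ) = y * cᵀ * (a * vᵀ) := by
    rw [Matrix.mul_assoc, ← Matrix.mul_assoc aᵀ, h₁]; simp only [Matrix.mul_assoc]
  have e₂ : y * aᵀ * (d * uᵀ) = y * uᵀ + y * cᵀ * (b * uᵀ) := by
    rw [Matrix.mul_assoc, ← Matrix.mul_assoc aᵀ, h₂]
    simp only [Matrix.mul_assoc, Matrix.add_mul, Matrix.mul_add, Matrix.one_mul]
  have e₃ : x * dᵀ * (a * vᵀ) = x * vᵀ + x * bᵀ * (c * vᵀ) := by
    rw [Matrix.mul_assoc, ← Matrix.mul_assoc dᵀ, h₃]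
    simp only [Matrix.mul_assoc, Matrix.add_mul, Matrix.mul_add, Matrix.one_mul]
  have e₄ : x * bᵀ * (d * uᵀ) = x * dᵀ * (b * uᵀ) := by
    rw [Matrix.mul_assoc, ← Matrix.mul_assoc bᵀ, h₄]; simp only [Matrix.mul_assoc]
  simp only [transpose_add, transpose_sub, transpose_neg, transpose_mul, transpose_transpose,
    Matrix.add_mul, Matrix.mul_add, Matrix.sub_mul, Matrix.mul_sub, Matrix.neg_mul,
    Matrix.mul_neg, e₁, e₂, e₃, e₄]
  abel

/-- Invariance of the one-form `λ^R = dκ − p·dqᵗ + q·dpᵗ` under the action of the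
real Jacobi group on the extended Siegel–Jacobi upper half space. -/
theorem lambdaR_invariant (n : ℕ) (a b c d : Matrix (Fin n) (Fin n) ℝ)
    (hM : (fromBlocks a b c d)ᵀ * Jmat n * fromBlocks a b c d = Jmat n)
    (lam mu : Matrix (Fin 1) (Fin n) ℝ) (κ : ℝ)
    (p' q' : ℝ → Matrix (Fin 1) (Fin n) ℝ) (κ' : ℝ → ℝ)
    (hp' : ∀ i j, Differentiable ℝ fun t => p' t i j)
    (hq' : ∀ i j, Differentiable ℝ fun t => q' t i j)
    (hκ' : Differentiable ℝ κ') (t : ℝ) :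
    letI p := lam * dᵀ - mu * cᵀ
    letI q := -(lam * bᵀ) + mu * aᵀ
    letI p₁ : ℝ → Matrix (Fin 1) (Fin n) ℝ := fun s => p + p' s * dᵀ - q' s * cᵀ
    letI q₁ : ℝ → Matrix (Fin 1) (Fin n) ℝ := fun s => q - p' s * bᵀ + q' s * aᵀ
    letI κ₁ : ℝ → ℝ := fun s =>
      κ + κ' s + (lam * (q' s)ᵀ) 0 0 - (mu * (p' s)ᵀ) 0 0
    deriv κ₁ t - (p₁ t * (mderiv q₁ t)ᵀ) 0 0 + (q₁ t * (mderiv p₁ t)ᵀ) 0 0 =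
      deriv κ' t - (p' t * (mderiv q' t)ᵀ) 0 0 + (q' t * (mderiv p' t)ᵀ) 0 0 := by
  let p := lam * dᵀ - mu * cᵀ
  let q := -(lam * bᵀ) + mu * aᵀ
  let p₁ : ℝ → Matrix (Fin 1) (Fin n) ℝ := fun s => p + p' s * dᵀ - q' s * cᵀ
  let q₁ : ℝ → Matrix (Fin 1) (Fin n) ℝ := fun s => q - p' s * bᵀ + q' s * aᵀ
  let κ₁ : ℝ → ℝ := fun s => κ + κ' s + (lam * (q' s)ᵀ) 0 0 - (mu * (p' s)ᵀ) 0 0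
  change deriv κ₁ t - (p₁ t * (mderiv q₁ t)ᵀ) 0 0 + (q₁ t * (mderiv p₁ t)ᵀ) 0 0 = _
  have hp := fun i j => (hp' i j) t
  have hq := fun i j => (hq' i j) t
  have hdp : mderiv p₁ t = mderiv p' t * dᵀ - mderiv q' t * cᵀ := by
    ext i j
    exact (((hasDerivAt_mul_const_apply hp dᵀ i j).const_add (p i j)).sub
      (hasDerivAt_mul_const_apply hq cᵀ i j)).deriv
  have hdq : mderiv q₁ t = -(mderiv p' t * bᵀ) + mderiv q' t * aᵀ := by
    ext i j
    exact (((hasDerivAt_mul_const_apply hp bᵀ i j).const_sub (q i j)).add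
      (hasDerivAt_mul_const_apply hq aᵀ i j)).deriv
  have hdκ : deriv κ₁ t = deriv κ' t + (lam * (mderiv q' t)ᵀ) 0 0 -
      (mu * (mderiv p' t)ᵀ) 0 0 :=
    ((((hκ' t).hasDerivAt.const_add κ).add
      (hasDerivAt_const_mul_transpose_apply hq lam 0 0)).sub
      (hasDerivAt_const_mul_transpose_apply hp mu 0 0)).deriv
  have hp₁ : p₁ t = (lam + p' t) * dᵀ - (mu + q' t) * cᵀ := by
    simp only [p₁, p, Matrix.add_mul]; abel
  have hq₁ : q₁ t = -((lam + p' t) * bᵀ) + (mu + q' t) * aᵀ := by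
    simp only [q₁, q, Matrix.add_mul]; abel
  have key := congrFun (congrFun (symplectic_pairing_invariant hM (lam + p' t) (mu + q' t)
    (mderiv p' t) (mderiv q' t)) 0) 0
  rw [← hp₁, ← hq₁, ← hdp, ← hdq] at key
  simp only [Matrix.add_mul, Matrix.sub_apply, Matrix.add_apply] at key
  rw [hdκ]
  linarith
end

section
/- The Möbius action of Sp(n,ℝ) on the Siegel upper half space is well defined: for every M = [[a,b],[c,d]] ∈ Sp(n,ℝ) and every v ∈ 𝒳ₙ, the matrix cv + d is invertible, and M·v := (av + b)(cv + d)^{-1} belongs to 𝒳ₙ, i.e. M·v is complex symmetric and its imaginary part (M·v − conj(M·v))/(2i) is positive definite. -/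
open Matrix

open scoped ComplexOrder MatrixOrder Matrix.Norms.L2Operator in
/-- A real matrix which is positive definite remains so as a complex matrix. -/
theorem Matrix.PosDef.map_complexOfReal {ι : Type*} [Fintype ι]
    {A : Matrix ι ι ℝ} (hA : A.PosDef) : (A.map Complex.ofReal).PosDef := by
  classical
  obtain ⟨B, hB, rfl⟩ := CStarAlgebra.isStrictlyPositive_iff_eq_star_mul_self.mp
    hA.isStrictlyPositive
  have h : (star B * B).map Complex.ofReal = (B.map Complex.ofReal)ᴴ * B.map Complex.ofReal := by
    ext i j
    simp [mul_apply, star_eq_conjTranspose]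
  rw [h]
  have hU : IsUnit (B.map Complex.ofReal) := hB.map (Complex.ofRealHom.mapMatrix)
  exact PosDef.conjTranspose_mul_self _ (mulVec_injective_iff_isUnit.mpr hU)

open scoped ComplexOrder in
/-- A real matrix which is positive definite as a complex matrix is positive definite. -/
theorem Matrix.PosDef.of_map_complexOfReal {ι : Type*} [Fintype ι]
    {A : Matrix ι ι ℝ} (hA : (A.map Complex.ofReal).PosDef) : A.PosDef := by
  refine .of_dotProduct_mulVec_pos ?_ fun x hx => ?_
  · ext i j
    simpa using congrArg Complex.re (hA.isHermitian.apply i j)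
  · have hx' : (fun i => (x i : ℂ)) ≠ 0 := fun h =>
      hx (funext fun i => by simpa using congrFun h i)
    have h := hA.dotProduct_mulVec_pos hx'
    have e : star (fun i => (x i : ℂ)) ⬝ᵥ (A.map Complex.ofReal *ᵥ fun i => (x i : ℂ)) =
        ((star x ⬝ᵥ (A *ᵥ x) : ℝ) : ℂ) := by
      simp [dotProduct, mulVec]
    rw [e] at h
    exact_mod_cast h

/-- The imaginary part of a symmetric complex matrix, via its conjugate transpose. -/
theorem Matrix.sub_conjTranspose_of_transpose_eq {ι : Type*} {v : Matrix ι ι ℂ} (hv : vᵀ = v) :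
    v - vᴴ = (2 * Complex.I) • (v.map Complex.im).map Complex.ofReal := by
  ext i j
  have h : v j i = v i j := congrFun (congrFun hv i) j
  apply Complex.ext <;> simp [h]; ring

/-- The Möbius action of `Sp(n,ℝ)` on the Siegel upper half space `𝒳ₙ` is well
defined: for `M = [[a,b],[c,d]] ∈ Sp(n,ℝ)` and `v ∈ 𝒳ₙ`, `cv + d` is invertible,
and `M·v = (av + b)(cv + d)⁻¹` is symmetric with positive definite imaginary part. -/
theorem moebius_wellDefined (n : ℕ) (a b c d : Matrix (Fin n) (Fin n) ℝ)
    (hM : (fromBlocks a b c d)ᵀ * Jmat n * fromBlocks a b c d = Jmat n)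
    (v : Matrix (Fin n) (Fin n) ℂ)
    (hv_symm : vᵀ = v) (hv_pd : (v.map Complex.im).PosDef) :
    letI Mv := (a.map Complex.ofReal * v + b.map Complex.ofReal) *
      (c.map Complex.ofReal * v + d.map Complex.ofReal)⁻¹
    IsUnit (c.map Complex.ofReal * v + d.map Complex.ofReal) ∧
    Mvᵀ = Mv ∧ (Mv.map Complex.im).PosDef := by
  have hT : ∀ X : Matrix (Fin n) (Fin n) ℝ,
      (X.map Complex.ofReal)ᴴ = (X.map Complex.ofReal)ᵀ := fun X => by ext i j; simp
  have h_ofReal : ∀ X Y Z W R : Matrix (Fin n) (Fin n) ℝ,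
      -(Xᵀ * Y) + Zᵀ * W = R →
      (Z.map Complex.ofReal)ᵀ * W.map Complex.ofReal =
        (X.map Complex.ofReal)ᵀ * Y.map Complex.ofReal + R.map Complex.ofReal := by
    rintro X Y Z W R rfl
    ext i j
    simp [mul_apply]
  simp only [Jmat, fromBlocks_transpose, fromBlocks_multiply, fromBlocks_inj, mul_zero, mul_one,
    mul_neg, zero_add, add_zero, neg_mul] at hM
  obtain ⟨h₁₁, h₁₂, -, h₂₂⟩ := hM
  have hac := h_ofReal _ _ _ _ _ h₁₁
  have had := h_ofReal _ _ _ _ _ h₁₂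
  have hbd := h_ofReal _ _ _ _ _ h₂₂
  have hda := congrArg transpose had
  simp only [Matrix.map_zero _ Complex.ofReal_zero, add_zero,
    Matrix.map_one _ Complex.ofReal_zero Complex.ofReal_one, transpose_add, transpose_mul,
    transpose_transpose, transpose_one] at hac had hbd hda
  set A := a.map Complex.ofReal
  set B := b.map Complex.ofReal
  set C := c.map Complex.ofReal
  set D := d.map Complex.ofReal
  have key : ∀ u : Matrix (Fin n) (Fin n) ℂ,
      (u * Cᵀ + Dᵀ) * (A * v + B) - (u * Aᵀ + Bᵀ) * (C * v + D) = v - u := by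
    intro u
    have e : (u * Cᵀ + Dᵀ) * (A * v + B) - (u * Aᵀ + Bᵀ) * (C * v + D) =
        u * (Cᵀ * A) * v + u * (Cᵀ * B) + (Dᵀ * A) * v + Dᵀ * B
          - u * (Aᵀ * C) * v - u * (Aᵀ * D) - (Bᵀ * C) * v - Bᵀ * D := by
      noncomm_ring
    rw [e, hac, had, hbd, hda]
    noncomm_ring
  set P := A * v + B with hP
  set Q := C * v + D with hQ
  have hsymm : Qᵀ * P = Pᵀ * Q := by
    have := key v
    rw [sub_self, sub_eq_zero] at this
    simpa [hP, hQ, hv_symm] using this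
  have hherm : Qᴴ * P - Pᴴ * Q = v - vᴴ := by
    rw [← key vᴴ]
    simp only [hP, hQ, conjTranspose_add, conjTranspose_mul, A, B, C, D, hT]
  have hY := hv_pd.map_complexOfReal
  rw [sub_conjTranspose_of_transpose_eq hv_symm] at hherm
  set Y := (v.map Complex.im).map Complex.ofReal
  have hQu : IsUnit Q := by
    rw [← mulVec_injective_iff_isUnit, ← coe_mulVecLin, ← LinearMap.ker_eq_bot,
      LinearMap.ker_eq_bot']
    intro x hx
    replace hx : Q *ᵥ x = 0 := hx
    by_contra hx0
    have hne : star x ⬝ᵥ (Y *ᵥ x) ≠ 0 := open scoped ComplexOrder in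
      (hY.dotProduct_mulVec_pos hx0).ne'
    have h := congrArg (fun M => star x ⬝ᵥ (M *ᵥ x)) hherm
    simp only [sub_mulVec, smul_mulVec, dotProduct_smul, ← mulVec_mulVec, hx, mulVec_zero,
      sub_zero] at h
    rw [dotProduct_mulVec, ← star_mulVec, hx, star_zero, zero_dotProduct] at h
    simp [hne] at h
  have hdet : IsUnit Q.det := (isUnit_iff_isUnit_det Q).mp hQu
  have hWT : (P * Q⁻¹)ᵀ = P * Q⁻¹ := by
    have hdT : IsUnit Qᵀ.det := by rwa [det_transpose]
    calc (P * Q⁻¹)ᵀ = Qᵀ⁻¹ * (Pᵀ * Q) * Q⁻¹ := by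
          rw [transpose_mul, transpose_nonsing_inv, Matrix.mul_assoc,
            mul_nonsing_inv_cancel_right _ _ hdet]
      _ = P * Q⁻¹ := by rw [← hsymm, nonsing_inv_mul_cancel_left _ _ hdT]
  refine ⟨hQu, hWT, .of_map_complexOfReal ?_⟩
  have hdH : IsUnit Qᴴ.det := by rw [det_conjTranspose]; exact hdet.star
  have hW : ((P * Q⁻¹).map Complex.im).map Complex.ofReal = (Q⁻¹)ᴴ * Y * Q⁻¹ := by
    have h2 : (2 * Complex.I) ≠ 0 := by simp
    apply smul_right_injective _ h2
    simp only
    rw [← sub_conjTranspose_of_transpose_eq hWT, ← Matrix.smul_mul, ← Matrix.mul_smul, ← hherm,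
      Matrix.mul_sub, Matrix.sub_mul, conjTranspose_nonsing_inv,
      nonsing_inv_mul_cancel_left _ _ hdH, conjTranspose_mul, Matrix.mul_assoc _ _ Q⁻¹,
      mul_nonsing_inv_cancel_right _ _ hdet, conjTranspose_nonsing_inv]
  rw [hW]
  open scoped ComplexOrder in
  exact hY.conjTranspose_mul_mul_same
    (mulVec_injective_iff_isUnit.mpr ((isUnit_nonsing_inv_iff).mpr hQu))
end

section
/- Transitivity of the Möbius action of Sp(n,ℝ) on the Siegel upper half space: for every v = X + iY ∈ 𝒳ₙ (X, Y real symmetric, Y positive definite), the matrix M_{X+iY} := [[√Y, X·√(Y^{-1})],[0, √(Y^{-1})]] (where √Y denotes the symmetric positive-definite square root of Y) belongs to Sp(n,ℝ) and satisfies M_{X+iY}·(i·I) = X + iY under the Möbius action M·v = (av + b)(cv + d)^{-1}. In particular Sp(n,ℝ) acts transitively on 𝒳ₙ. -/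
open Matrix

open scoped MatrixOrder in
/-- Positive definite square roots of `Y` and `Y⁻¹` are inverse to each other. -/
theorem Matrix.PosDef.mul_eq_one_of_mul_self_eq_inv {n : Type*} [Fintype n] [DecidableEq n]
    {Y s t : Matrix n n ℝ} (hs : s.PosDef) (ht : t.PosDef) (hss : s * s = Y)
    (htt : t * t = Y⁻¹) : s * t = 1 := by
  have h : t = s⁻¹ := by
    refine (CFC.mul_self_eq_mul_self_iff t s⁻¹ ht.posSemidef.nonneg
      hs.inv.posSemidef.nonneg).1 ?_
    rw [htt, ← hss, Matrix.mul_inv_rev]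
  rw [h, Matrix.mul_nonsing_inv _ ((Matrix.isUnit_iff_isUnit_det s).1 hs.isUnit)]

open scoped MatrixOrder in
theorem Matrix.PosDef.exists_symm_mul_self_eq {n : Type*} [Fintype n] [DecidableEq n]
    {Y : Matrix n n ℝ} (hY : Y.PosDef) :
    ∃ s : Matrix n n ℝ, sᵀ = s ∧ IsUnit s.det ∧ s * s = Y := by
  have hsq : CFC.sqrt Y * CFC.sqrt Y = Y := CFC.sqrt_mul_sqrt_self Y hY.posSemidef.nonneg
  refine ⟨CFC.sqrt Y, ?_, ?_, hsq⟩
  · have h := (CFC.sqrt_nonneg Y).posSemidef.isHermitian.eq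
    rwa [Matrix.conjTranspose_eq_transpose_of_trivial] at h
  · have h := (Matrix.isUnit_iff_isUnit_det Y).1 hY.isUnit
    rw [← hsq, Matrix.det_mul] at h
    exact isUnit_of_mul_isUnit_left h

theorem transpose_mul_Jmat_mul_fromBlocks {n : ℕ} {X s t : Matrix (Fin n) (Fin n) ℝ}
    (hX : Xᵀ = X) (hs : sᵀ = s) (ht : tᵀ = t) (hst : s * t = 1) :
    (fromBlocks s (X * t) 0 t)ᵀ * Jmat n * fromBlocks s (X * t) 0 t = Jmat n := by
  have hts : t * s = 1 := mul_eq_one_comm.1 hst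
  simp [Jmat, fromBlocks_transpose, fromBlocks_multiply, hX, hs, ht, hst, hts, Matrix.mul_assoc]

theorem moebius_fromBlocks_I {n : ℕ} {X Y s t : Matrix (Fin n) (Fin n) ℝ}
    (hss : s * s = Y) (hst : s * t = 1) :
    (s.map Complex.ofReal * (Complex.I • (1 : Matrix (Fin n) (Fin n) ℂ)) +
        (X * t).map Complex.ofReal) *
      ((0 : Matrix (Fin n) (Fin n) ℂ) * (Complex.I • (1 : Matrix (Fin n) (Fin n) ℂ)) +
        t.map Complex.ofReal)⁻¹ =
      X.map Complex.ofReal + Complex.I • Y.map Complex.ofReal := by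
  have map_mul (A B : Matrix (Fin n) (Fin n) ℝ) :
      (A * B).map Complex.ofReal = A.map Complex.ofReal * B.map Complex.ofReal :=
    Matrix.map_mul (f := Complex.ofRealHom)
  have hts : t.map Complex.ofReal * s.map Complex.ofReal = 1 := by
    rw [← map_mul, mul_eq_one_comm.1 hst]
    simp
  rw [Matrix.zero_mul, zero_add, Matrix.inv_eq_right_inv hts, ← hss, map_mul, map_mul,
    Matrix.add_mul, Matrix.mul_assoc (X.map Complex.ofReal), hts]
  simp [add_comm]

/-- Transitivity of the Möbius action of `Sp(n,ℝ)` on the Siegel upper half space: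
for `v = X + iY ∈ 𝒳ₙ`, with `s = √Y` and `s' = √(Y⁻¹)` the symmetric
positive-definite square roots, the matrix `M = [[s, X·s'],[0, s']]` is symplectic
and maps `i·I` to `X + iY` under the Möbius action `M·v = (av + b)(cv + d)⁻¹`.
In particular, `Sp(n,ℝ)` acts transitively on `𝒳ₙ`. -/
theorem moebius_transitive (n : ℕ) (X Y : Matrix (Fin n) (Fin n) ℝ)
    (hX_symm : Xᵀ = X) (hY_symm : Yᵀ = Y) (hY_pd : Y.PosDef)
    (s : Matrix (Fin n) (Fin n) ℝ) (hs_symm : sᵀ = s) (hs_pd : s.PosDef)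
    (hs_sq : s * s = Y)
    (s' : Matrix (Fin n) (Fin n) ℝ) (hs'_symm : s'ᵀ = s') (hs'_pd : s'.PosDef)
    (hs'_sq : s' * s' = Y⁻¹) :
    ((fromBlocks s (X * s') 0 s')ᵀ * Jmat n * fromBlocks s (X * s') 0 s' = Jmat n ∧
      (s.map Complex.ofReal * (Complex.I • (1 : Matrix (Fin n) (Fin n) ℂ)) +
          (X * s').map Complex.ofReal) *
        ((0 : Matrix (Fin n) (Fin n) ℂ) * (Complex.I • (1 : Matrix (Fin n) (Fin n) ℂ)) +
          s'.map Complex.ofReal)⁻¹ =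
        X.map Complex.ofReal + Complex.I • Y.map Complex.ofReal) ∧
    (∀ X₀ Y₀ : Matrix (Fin n) (Fin n) ℝ, X₀ᵀ = X₀ → Y₀ᵀ = Y₀ → Y₀.PosDef →
      ∃ a b c d : Matrix (Fin n) (Fin n) ℝ,
        (fromBlocks a b c d)ᵀ * Jmat n * fromBlocks a b c d = Jmat n ∧
        (a.map Complex.ofReal * (Complex.I • (1 : Matrix (Fin n) (Fin n) ℂ)) +
            b.map Complex.ofReal) *
          (c.map Complex.ofReal * (Complex.I • (1 : Matrix (Fin n) (Fin n) ℂ)) +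
            d.map Complex.ofReal)⁻¹ =
          X₀.map Complex.ofReal + Complex.I • Y₀.map Complex.ofReal) := by
  have hst := hs_pd.mul_eq_one_of_mul_self_eq_inv hs'_pd hs_sq hs'_sq
  refine ⟨⟨transpose_mul_Jmat_mul_fromBlocks hX_symm hs_symm hs'_symm hst,
    moebius_fromBlocks_I hs_sq hst⟩, fun X₀ Y₀ hX₀ _ hY₀ => ?_⟩
  obtain ⟨r, hr, hdet, hrr⟩ := hY₀.exists_symm_mul_self_eq
  have hinv : r * r⁻¹ = 1 := Matrix.mul_nonsing_inv r hdet
  refine ⟨r, X₀ * r⁻¹, 0, r⁻¹, transpose_mul_Jmat_mul_fromBlocks hX₀ hr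
    (by rw [Matrix.transpose_nonsing_inv, hr]) hinv, ?_⟩
  rw [Matrix.map_zero _ Complex.ofReal_zero]
  exact moebius_fromBlocks_I hrr hinv
end
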